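/- arXiv:0712.1182 — 8 statements merged into one kernel-verified Lean document; each statement's English description precedes it below -/
import Mathlib

section
/- Let ω^A = (b^A, u^A) and ω^B = (b^B, u^B) be multinomial opinions over a frame of k elements with u^A + u^B - u^A·u^B ≠ 0. Then their cumulative fusion ω^{A⋄B} = (b^{A⋄B}, u^{A⋄B}) is again a multinomial opinion: b^{A⋄B}_i ≥ 0 for all i, u^{A⋄B} ≥ 0, and u^{A⋄B} + ∑_i b^{A⋄B}_i = 1. -/
/-- Belief mass vector of the cumulative fusion of two opinions. -/
noncomputable def cumFuseB {k : ℕ} (bA bB : Fin k → ℝ) (uA uB : ℝ) : Fin k → ℝ :=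
  fun i => (bA i * uB + bB i * uA) / (uA + uB - uA * uB)

/-- Uncertainty mass of the cumulative fusion of two opinions. -/
noncomputable def cumFuseU (uA uB : ℝ) : ℝ := uA * uB / (uA + uB - uA * uB)

/-- Cumulative fusion of two multinomial opinions is again a multinomial opinion. -/
theorem cumulative_fusion_is_opinion (k : ℕ) (bA bB : Fin k → ℝ) (uA uB : ℝ)
    (hbA : ∀ i, 0 ≤ bA i) (huA : 0 ≤ uA) (haddA : uA + ∑ i, bA i = 1)
    (hbB : ∀ i, 0 ≤ bB i) (huB : 0 ≤ uB) (haddB : uB + ∑ i, bB i = 1)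
    (hden : uA + uB - uA * uB ≠ 0) :
    (∀ i, 0 ≤ cumFuseB bA bB uA uB i) ∧ 0 ≤ cumFuseU uA uB ∧
      cumFuseU uA uB + ∑ i, cumFuseB bA bB uA uB i = 1 := by
  have hA : uA ≤ 1 := by linarith [Finset.sum_nonneg fun i (_ : i ∈ Finset.univ) => hbA i]
  have hpos : 0 ≤ uA + uB - uA * uB := by nlinarith
  refine ⟨fun i => ?_, div_nonneg (mul_nonneg huA huB) hpos, ?_⟩
  · exact div_nonneg (add_nonneg (mul_nonneg (hbA i) huB) (mul_nonneg (hbB i) huA)) hpos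
  · simp only [cumFuseU, cumFuseB]
    rw [← Finset.sum_div, Finset.sum_add_distrib, ← Finset.sum_mul, ← Finset.sum_mul,
      ← add_div, div_eq_one_iff_eq hden]
    linear_combination uB * haddA + uA * haddB
end

section
/- The cumulative fusion operator is associative: for multinomial opinions ω^A = (b^A, u^A), ω^B = (b^B, u^B), ω^C = (b^C, u^C) over a frame of k elements with u^A > 0, u^B > 0 and u^C > 0, one has (ω^A ⊕ ω^B) ⊕ ω^C = ω^A ⊕ (ω^B ⊕ ω^C), i.e. the belief mass vectors and uncertainty masses of the two iterated fusions coincide (all intermediate denominators being nonzero under these hypotheses). -/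
lemma cumFuse_denom_pos {u v : ℝ} (hu : 0 < u) (hv : 0 < v) (hu1 : u ≤ 1) :
    0 < u + v - u * v := by
  nlinarith [mul_nonneg hv.le (sub_nonneg.2 hu1)]

lemma cumFuseU_add_sub_mul {u v w : ℝ} (h : u + v - u * v ≠ 0) :
    cumFuseU u v + w - cumFuseU u v * w
      = (u * v + u * w + v * w - 2 * (u * v * w)) / (u + v - u * v) := by
  unfold cumFuseU
  field_simp
  ring

/-- The uncertainty of an iterated fusion, as a function symmetric in the three uncertainties. -/
lemma cumFuseU_cumFuseU {u v w : ℝ} (h : u + v - u * v ≠ 0) :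
    cumFuseU (cumFuseU u v) w = u * v * w / (u * v + u * w + v * w - 2 * (u * v * w)) := by
  rw [cumFuseU, cumFuseU_add_sub_mul h, cumFuseU, div_mul_eq_mul_div, div_div_div_cancel_right₀ h]

/-- The belief masses of an iterated fusion, as a function symmetric in the three opinions. -/
lemma cumFuseB_cumFuseB {k : ℕ} (a b c : Fin k → ℝ) {u v w : ℝ} (h : u + v - u * v ≠ 0)
    (i : Fin k) :
    cumFuseB (cumFuseB a b u v) c (cumFuseU u v) w i
      = (a i * v * w + b i * u * w + c i * u * v)
        / (u * v + u * w + v * w - 2 * (u * v * w)) := by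
  have hnum : (a i * v + b i * u) / (u + v - u * v) * w + c i * (u * v / (u + v - u * v))
      = (a i * v * w + b i * u * w + c i * u * v) / (u + v - u * v) := by
    ring
  rw [cumFuseB, cumFuseU_add_sub_mul h, cumFuseB, cumFuseU, hnum, div_div_div_cancel_right₀ h]

lemma cumFuseU_comm (u v : ℝ) : cumFuseU u v = cumFuseU v u := by
  simp only [cumFuseU, mul_comm, add_comm]

lemma cumFuseB_comm {k : ℕ} (a b : Fin k → ℝ) (u v : ℝ) :
    cumFuseB a b u v = cumFuseB b a v u := by
  funext i
  simp only [cumFuseB, mul_comm, add_comm]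

/-- The cumulative fusion operator is associative. -/
theorem cumulative_fusion_assoc (k : ℕ) (bA bB bC : Fin k → ℝ) (uA uB uC : ℝ)
    (hbA : ∀ i, 0 ≤ bA i) (huA : 0 < uA) (haddA : uA + ∑ i, bA i = 1)
    (hbB : ∀ i, 0 ≤ bB i) (huB : 0 < uB) (haddB : uB + ∑ i, bB i = 1)
    (hbC : ∀ i, 0 ≤ bC i) (huC : 0 < uC) (haddC : uC + ∑ i, bC i = 1) :
    cumFuseB (cumFuseB bA bB uA uB) bC (cumFuseU uA uB) uC
      = cumFuseB bA (cumFuseB bB bC uB uC) uA (cumFuseU uB uC) ∧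
    cumFuseU (cumFuseU uA uB) uC = cumFuseU uA (cumFuseU uB uC) := by
  have le_one {b : Fin k → ℝ} {u : ℝ} (hb : ∀ i, 0 ≤ b i) (hadd : u + ∑ i, b i = 1) : u ≤ 1 := by
    linarith [Finset.sum_nonneg fun i (_ : i ∈ Finset.univ) => hb i]
  have hAB := (cumFuse_denom_pos huA huB (le_one hbA haddA)).ne'
  have hBC := (cumFuse_denom_pos huB huC (le_one hbB haddB)).ne'
  constructor
  · funext i
    rw [cumFuseB_comm bA (cumFuseB bB bC uB uC), cumFuseB_cumFuseB _ _ _ hAB,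
      cumFuseB_cumFuseB _ _ _ hBC]
    ring
  · rw [cumFuseU_comm uA (cumFuseU uB uC), cumFuseU_cumFuseU hAB, cumFuseU_cumFuseU hBC]
    ring
end

section
/- Let ω^A = (b^A, u^A) and ω^B = (b^B, u^B) be multinomial opinions over a frame of k elements with u^A + u^B ≠ 0. Then their averaging fusion ω^{A⊻B} = (b^{A⊻B}, u^{A⊻B}) is again a multinomial opinion: b^{A⊻B}_i ≥ 0 for all i, u^{A⊻B} ≥ 0, and u^{A⊻B} + ∑_i b^{A⊻B}_i = 1. -/
/-- Belief mass vector of the averaging fusion of two opinions. -/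
noncomputable def avgFuseB {k : ℕ} (bA bB : Fin k → ℝ) (uA uB : ℝ) : Fin k → ℝ :=
  fun i => (bA i * uB + bB i * uA) / (uA + uB)

/-- Uncertainty mass of the averaging fusion of two opinions. -/
noncomputable def avgFuseU (uA uB : ℝ) : ℝ := 2 * uA * uB / (uA + uB)

/-- Averaging fusion of two multinomial opinions is again a multinomial opinion. -/
theorem averaging_fusion_is_opinion (k : ℕ) (bA bB : Fin k → ℝ) (uA uB : ℝ)
    (hbA : ∀ i, 0 ≤ bA i) (huA : 0 ≤ uA) (haddA : uA + ∑ i, bA i = 1)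
    (hbB : ∀ i, 0 ≤ bB i) (huB : 0 ≤ uB) (haddB : uB + ∑ i, bB i = 1)
    (hden : uA + uB ≠ 0) :
    (∀ i, 0 ≤ avgFuseB bA bB uA uB i) ∧ 0 ≤ avgFuseU uA uB ∧
      avgFuseU uA uB + ∑ i, avgFuseB bA bB uA uB i = 1 := by
  refine ⟨fun i => ?_, ?_, ?_⟩
  · have hA := hbA i
    have hB := hbB i
    unfold avgFuseB
    positivity
  · unfold avgFuseU
    positivity
  · have hA : ∑ i, bA i = 1 - uA := by linarith
    have hB : ∑ i, bB i = 1 - uB := by linarith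
    simp only [avgFuseU, avgFuseB]
    rw [← Finset.sum_div, Finset.sum_add_distrib, ← Finset.sum_mul, ← Finset.sum_mul, hA, hB,
      ← add_div, div_eq_one_iff_eq hden]
    ring
end

section
/- Cumulative fission inverts cumulative fusion: let ω^A = (b^A, u^A) and ω^B = (b^B, u^B) be multinomial opinions over a frame of k elements with u^A > 0 and u^B > 0, and let ω^C = ω^A ⊕ ω^B be their cumulative fusion. Then u^B - u^C + u^B·u^C ≠ 0 and the cumulative fission ω^C ⊖ ω^B equals ω^A, i.e. b^{C⊘B}_i = b^A_i for all i and u^{C⊘B} = u^A. -/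
/-- Belief mass vector of the cumulative fission of `(bC, uC)` by `(bB, uB)`. -/
noncomputable def cumFissB {k : ℕ} (bC bB : Fin k → ℝ) (uC uB : ℝ) : Fin k → ℝ :=
  fun i => (bC i * uB - bB i * uC) / (uB - uC + uB * uC)

/-- Uncertainty mass of the cumulative fission of `(bC, uC)` by `(bB, uB)`. -/
noncomputable def cumFissU (uC uB : ℝ) : ℝ := uB * uC / (uB - uC + uB * uC)

/-- The denominator of the cumulative fusion of two opinions is positive. -/
theorem cumFuse_denom_pos_s8 {uA uB : ℝ} (huA : 0 < uA) (hA : uA ≤ 1) (huB : 0 < uB) :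
    0 < uA + uB - uA * uB := by
  nlinarith [mul_nonneg huB.le (sub_nonneg.2 hA)]

/-- The denominator of the fission of a cumulative fusion by its second operand. -/
theorem cumFiss_denom_cumFuseU {uA uB : ℝ} (hD : uA + uB - uA * uB ≠ 0) :
    uB - cumFuseU uA uB + uB * cumFuseU uA uB = uB ^ 2 / (uA + uB - uA * uB) := by
  unfold cumFuseU
  generalize h : uA + uB - uA * uB = D at hD ⊢
  field_simp
  linear_combination -uB * h

/-- Cumulative fission inverts cumulative fusion. -/
theorem cumulative_fission_inverts_fusion (k : ℕ) (bA bB : Fin k → ℝ) (uA uB : ℝ)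
    (hbA : ∀ i, 0 ≤ bA i) (huA : 0 < uA) (haddA : uA + ∑ i, bA i = 1)
    (hbB : ∀ i, 0 ≤ bB i) (huB : 0 < uB) (haddB : uB + ∑ i, bB i = 1) :
    uB - cumFuseU uA uB + uB * cumFuseU uA uB ≠ 0 ∧
    (∀ i, cumFissB (cumFuseB bA bB uA uB) bB (cumFuseU uA uB) uB i = bA i) ∧
    cumFissU (cumFuseU uA uB) uB = uA := by
  have hA : uA ≤ 1 := by linarith [Finset.sum_nonneg fun i (_ : i ∈ Finset.univ) => hbA i]
  have hD := (cumFuse_denom_pos_s8 huA hA huB).ne'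
  have hden := cumFiss_denom_cumFuseU hD
  refine ⟨by rw [hden]; positivity, fun i => ?_, ?_⟩
  · rw [cumFissB, hden, cumFuseB, cumFuseU]
    generalize uA + uB - uA * uB = D at hD ⊢
    field_simp
    ring
  · rw [cumFissU, hden, cumFuseU]
    generalize uA + uB - uA * uB = D at hD ⊢
    field_simp
end

section
/- Cumulative fusion inverts cumulative fission: let ω^C = (b^C, u^C) and ω^B = (b^B, u^B) be pairs of real belief vectors and uncertainty masses over a frame of k elements with u^B > 0, u^C > 0 and u^B - u^C + u^B·u^C ≠ 0, and let ω^A = ω^C ⊖ ω^B be the cumulative fission. If u^A + u^B - u^A·u^B ≠ 0 (where u^A = u^{C⊘B}), then the cumulative fusion ω^A ⊕ ω^B equals ω^C, i.e. b^{A⋄B}_i = b^C_i for all i and u^{A⋄B} = u^C. -/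
/-- The denominator of the fusion of a fission `C ⊖ B` with `B`. -/
theorem cumFissU_add_sub_mul {uC uB : ℝ} (hden : uB - uC + uB * uC ≠ 0) :
    cumFissU uC uB + uB - cumFissU uC uB * uB = uB ^ 2 / (uB - uC + uB * uC) := by
  unfold cumFissU
  rw [eq_div_iff hden, sub_mul, add_mul, mul_right_comm, div_mul_cancel₀ _ hden]
  ring

/-- Cumulative fusion inverts cumulative fission. -/
theorem cumulative_fusion_inverts_fission (k : ℕ) (bC bB : Fin k → ℝ) (uC uB : ℝ)
    (huB : 0 < uB) (huC : 0 < uC) (hden : uB - uC + uB * uC ≠ 0)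
    (hden' : cumFissU uC uB + uB - cumFissU uC uB * uB ≠ 0) :
    (∀ i, cumFuseB (cumFissB bC bB uC uB) bB (cumFissU uC uB) uB i = bC i) ∧
    cumFuseU (cumFissU uC uB) uB = uC := by
  refine ⟨fun i => ?_, ?_⟩
  · rw [cumFuseB, div_eq_iff hden', cumFissU_add_sub_mul hden]
    unfold cumFissB cumFissU
    ring
  · rw [cumFuseU, div_eq_iff hden', cumFissU_add_sub_mul hden]
    unfold cumFissU
    ring
end

section
/- Averaging fission inverts averaging fusion: let ω^A = (b^A, u^A) and ω^B = (b^B, u^B) be multinomial opinions over a frame of k elements with u^A > 0 and u^B > 0, and let ω^C = ω^A ⊕̲ ω^B be their averaging fusion. Then 2·u^B - u^C ≠ 0 and the averaging fission ω^C ⊖̲ ω^B equals ω^A, i.e. b^{C⊘̲B}_i = b^A_i for all i and u^{C⊘̲B} = u^A. -/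
/-- Belief mass vector of the averaging fission of `(bC, uC)` by `(bB, uB)`. -/
noncomputable def avgFissB {k : ℕ} (bC bB : Fin k → ℝ) (uC uB : ℝ) : Fin k → ℝ :=
  fun i => (2 * bC i * uB - bB i * uC) / (2 * uB - uC)

/-- Uncertainty mass of the averaging fission of `(bC, uC)` by `(bB, uB)`. -/
noncomputable def avgFissU (uC uB : ℝ) : ℝ := uB * uC / (2 * uB - uC)

/-- The denominator of the fission of a fused opinion. -/
theorem two_mul_sub_avgFuseU {uA uB : ℝ} (h : uA + uB ≠ 0) :
    2 * uB - avgFuseU uA uB = 2 * uB ^ 2 / (uA + uB) := by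
  unfold avgFuseU
  field_simp
  ring

/-- Averaging fission inverts averaging fusion. -/
theorem averaging_fission_inverts_fusion (k : ℕ) (bA bB : Fin k → ℝ) (uA uB : ℝ)
    (hbA : ∀ i, 0 ≤ bA i) (huA : 0 < uA) (haddA : uA + ∑ i, bA i = 1)
    (hbB : ∀ i, 0 ≤ bB i) (huB : 0 < uB) (haddB : uB + ∑ i, bB i = 1) :
    2 * uB - avgFuseU uA uB ≠ 0 ∧
    (∀ i, avgFissB (avgFuseB bA bB uA uB) bB (avgFuseU uA uB) uB i = bA i) ∧
    avgFissU (avgFuseU uA uB) uB = uA := by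
  have hs : uA + uB ≠ 0 := (add_pos huA huB).ne'
  have hB : uB ≠ 0 := huB.ne'
  refine ⟨?_, fun i => ?_, ?_⟩
  · rw [two_mul_sub_avgFuseU hs]
    positivity
  · rw [avgFissB, two_mul_sub_avgFuseU hs, avgFuseB, avgFuseU]
    field_simp
    ring
  · rw [avgFissU, two_mul_sub_avgFuseU hs, avgFuseU]
    field_simp
end

section
/- Averaging fusion inverts averaging fission: let ω^C = (b^C, u^C) and ω^B = (b^B, u^B) be pairs of real belief vectors and uncertainty masses over a frame of k elements with u^B > 0, u^C > 0 and 2·u^B - u^C ≠ 0, and let ω^A = ω^C ⊖̲ ω^B be the averaging fission. If u^A + u^B ≠ 0 (where u^A = u^{C⊘̲B}), then the averaging fusion ω^A ⊕̲ ω^B equals ω^C, i.e. b^{A⊻B}_i = b^C_i for all i and u^{A⊻B} = u^C. -/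
theorem avgFissU_add (uC uB : ℝ) (hden : 2 * uB - uC ≠ 0) :
    avgFissU uC uB + uB = 2 * uB ^ 2 / (2 * uB - uC) := by
  unfold avgFissU
  rw [div_add' _ _ _ hden]
  ring

/-- Averaging fusion inverts averaging fission. -/
theorem averaging_fusion_inverts_fission (k : ℕ) (bC bB : Fin k → ℝ) (uC uB : ℝ)
    (huB : 0 < uB) (huC : 0 < uC) (hden : 2 * uB - uC ≠ 0)
    (hden' : avgFissU uC uB + uB ≠ 0) :
    (∀ i, avgFuseB (avgFissB bC bB uC uB) bB (avgFissU uC uB) uB i = bC i) ∧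
    avgFuseU (avgFissU uC uB) uB = uC := by
  have h := avgFissU_add uC uB hden
  refine ⟨fun i => ?_, ?_⟩
  · rw [avgFuseB, div_eq_iff hden', h, avgFissB, avgFissU]
    field_simp
    ring
  · rw [avgFuseU, div_eq_iff hden', h, avgFissU]
    field_simp
end

section
/- Cumulative fission preserves the additivity constraint: if ω^C = (b^C, u^C) and ω^B = (b^B, u^B) satisfy u^C + ∑_i b^C_i = 1 and u^B + ∑_i b^B_i = 1, and the denominator u^B - u^C + u^B·u^C is nonzero, then the cumulative fission ω^C ⊖ ω^B satisfies u^{C⊘B} + ∑_i b^{C⊘B}_i = 1. -/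
/-- Cumulative fission preserves the additivity constraint. -/
theorem cumulative_fission_additivity (k : ℕ) (bC bB : Fin k → ℝ) (uC uB : ℝ)
    (haddC : uC + ∑ i, bC i = 1) (haddB : uB + ∑ i, bB i = 1)
    (hden : uB - uC + uB * uC ≠ 0) :
    cumFissU uC uB + ∑ i, cumFissB bC bB uC uB i = 1 := by
  simp only [cumFissU, cumFissB]
  rw [← Finset.sum_div, ← add_div, div_eq_one_iff_eq hden, Finset.sum_sub_distrib,
    ← Finset.sum_mul, ← Finset.sum_mul]
  linear_combination uB * haddC - uC * haddB
end
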